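/- arXiv:1308.3247 — 2 statements merged into one kernel-verified Lean document; each statement's English description precedes it below -/
import Mathlib

section
/- Let 𝔽 ⊆ {1,2,*}^m be a monotone family and let ε ∈ (0,1). Then there exists p' ∈ [1−ε, 1−ε/2] such that the average sensitivity satisfies as_{p'}(𝔽) ≤ 4/ε. -/
open Finset

/-- The alphabet `{1, 2, *}`, where `none` stands for `*` and `some j` for the
values `1, 2`. -/
abbrev Star3 := Option (Fin 2)

/-- The weight of a single symbol under the measure `μ_p`: `*` gets `1 - p`,
each of `1` and `2` gets `p/2`. -/
noncomputable def star3Weight (p : ℝ) (a : Star3) : ℝ :=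
  if a = none then 1 - p else p / 2

/-- The product measure `μ_p` of a family `𝔽 ⊆ {1,2,*}^m`. -/
noncomputable def muP (p : ℝ) {m : ℕ} (F : Finset (Fin m → Star3)) : ℝ :=
  ∑ f ∈ F, ∏ i, star3Weight p (f i)

/-- A family is monotone if changing a `*` coordinate of a member to `1` or `2`
again yields a member. -/
def MonotoneFamily {m : ℕ} (F : Finset (Fin m → Star3)) : Prop :=
  ∀ f ∈ F, ∀ i : Fin m, f i = none → ∀ j : Fin 2, Function.update f i (some j) ∈ F

/-- The influence `Inf_i^p(𝔽)`: the `μ_p`-measure of the set of `F` with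
`F|_{i=*} ∉ 𝔽` and `F|_{i=j} ∈ 𝔽` for some `j ∈ {1,2}`. -/
noncomputable def infP (p : ℝ) {m : ℕ} (F : Finset (Fin m → Star3)) (i : Fin m) : ℝ :=
  muP p (Finset.univ.filter (fun f : Fin m → Star3 =>
    Function.update f i none ∉ F ∧ ∃ j : Fin 2, Function.update f i (some j) ∈ F))

/-- The average sensitivity `as_p(𝔽) = Σ_i Inf_i^p(𝔽)`. -/
noncomputable def avgSens (p : ℝ) {m : ℕ} (F : Finset (Fin m → Star3)) : ℝ :=
  ∑ i, infP p F i


/-- Resampling one coordinate over all letters and summing over all words counts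
each word three times. -/
lemma sum_sum_update {m : ℕ} (i : Fin m) (g : (Fin m → Star3) → ℝ) :
    ∑ f, ∑ a : Star3, g (Function.update f i a) = 3 * ∑ f, g f := by
  have hinv : Function.Involutive
      (fun x : (Fin m → Star3) × Star3 => (Function.update x.1 i x.2, x.1 i)) := by
    rintro ⟨f, a⟩
    simp
  rw [← Fintype.sum_prod_type', mul_sum,
    ← Equiv.sum_comp hinv.toPerm (fun x : (Fin m → Star3) × Star3 =>
      g (Function.update x.1 i x.2)), Fintype.sum_prod_type]
  simp [Function.Involutive.toPerm]

/-- The derivative of `star3Weight p a` in `p`. -/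
noncomputable def star3WeightDeriv (a : Star3) : ℝ :=
  if a = none then -1 else 1 / 2

lemma hasDerivAt_star3Weight (p : ℝ) (a : Star3) :
    HasDerivAt (fun q => star3Weight q a) (star3WeightDeriv a) p := by
  unfold star3Weight star3WeightDeriv
  split_ifs
  · simpa using (hasDerivAt_id p).const_sub 1
  · simpa using (hasDerivAt_id p).div_const 2

lemma star3Weight_nonneg {p : ℝ} (hp : p ∈ Set.Icc (0 : ℝ) 1) (a : Star3) :
    0 ≤ star3Weight p a := by
  unfold star3Weight
  split_ifs <;> linarith [hp.1, hp.2]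

lemma sum_star3Weight (p : ℝ) : ∑ a, star3Weight p a = 1 := by
  simp only [Fintype.sum_option, Fin.sum_univ_two, star3Weight]
  simp

lemma muP_nonneg {p : ℝ} (hp : p ∈ Set.Icc (0 : ℝ) 1) {m : ℕ}
    (F : Finset (Fin m → Star3)) : 0 ≤ muP p F :=
  sum_nonneg fun _ _ => prod_nonneg fun _ _ => star3Weight_nonneg hp _

lemma muP_le_one {p : ℝ} (hp : p ∈ Set.Icc (0 : ℝ) 1) {m : ℕ}
    (F : Finset (Fin m → Star3)) : muP p F ≤ 1 := by
  calc muP p F ≤ ∑ f : Fin m → Star3, ∏ i, star3Weight p (f i) :=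
        sum_le_sum_of_subset_of_nonneg (subset_univ F)
          fun _ _ _ => prod_nonneg fun _ _ => star3Weight_nonneg hp _
    _ = ∏ _i : Fin m, ∑ a, star3Weight p a := by
        rw [prod_univ_sum, Fintype.piFinset_univ]
    _ = 1 := prod_eq_one fun _ _ => sum_star3Weight p

/-- The contribution of the coordinate `i` to the derivative of `muP p F` in `p`. -/
noncomputable def muPDerivCoord (p : ℝ) {m : ℕ} (F : Finset (Fin m → Star3))
    (i : Fin m) : ℝ :=
  ∑ f ∈ F, (∏ k ∈ univ.erase i, star3Weight p (f k)) * star3WeightDeriv (f i)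

lemma hasDerivAt_muP (p : ℝ) {m : ℕ} (F : Finset (Fin m → Star3)) :
    HasDerivAt (fun q => muP q F) (∑ i, muPDerivCoord p F i) p := by
  unfold muP muPDerivCoord
  rw [sum_comm]
  refine HasDerivAt.fun_sum fun f _ => ?_
  simpa using HasDerivAt.fun_finsetProd (u := univ)
    fun i _ => hasDerivAt_star3Weight p (f i)

lemma prod_erase_update (p : ℝ) {m : ℕ} (f : Fin m → Star3) (i : Fin m) (a : Star3) :
    ∏ k ∈ univ.erase i, star3Weight p (Function.update f i a k) =
      ∏ k ∈ univ.erase i, star3Weight p (f k) :=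
  prod_congr rfl fun k hk => by rw [Function.update_of_ne (ne_of_mem_erase hk)]

/-- For monotone families, half of each influence is bounded by the corresponding
contribution to the derivative (one direction of Russo's formula). -/
lemma infP_le_two_mul_muPDerivCoord {p : ℝ} (hp : p ∈ Set.Icc (0 : ℝ) 1) {m : ℕ}
    {F : Finset (Fin m → Star3)} (hF : MonotoneFamily F) (i : Fin m) :
    infP p F i ≤ 2 * muPDerivCoord p F i := by
  have hinf : 3 * infP p F i = ∑ f : Fin m → Star3,
      if Function.update f i none ∉ F ∧ ∃ j : Fin 2, Function.update f i (some j) ∈ F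
        then ∏ k ∈ univ.erase i, star3Weight p (f k) else 0 := by
    unfold infP muP
    rw [sum_filter, ← sum_sum_update i]
    refine sum_congr rfl fun f _ => ?_
    simp only [Function.update_idem]
    split_ifs with h
    · simp only [← prod_erase_mul univ _ (mem_univ i), prod_erase_update,
        Function.update_self]
      rw [← mul_sum, sum_star3Weight, mul_one]
    · simp
  have hderiv : 3 * muPDerivCoord p F i = ∑ f : Fin m → Star3,
      (∏ k ∈ univ.erase i, star3Weight p (f k)) *
        ∑ a, if Function.update f i a ∈ F then star3WeightDeriv a else 0 := by
    unfold muPDerivCoord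
    rw [← Fintype.sum_ite_mem, ← sum_sum_update i]
    refine sum_congr rfl fun f _ => ?_
    rw [mul_sum]
    refine sum_congr rfl fun a _ => ?_
    simp only [prod_erase_update, Function.update_self]
    split_ifs <;> simp
  suffices h : 3 * infP p F i ≤ 2 * (3 * muPDerivCoord p F i) by linarith
  rw [hinf, hderiv, mul_sum]
  refine sum_le_sum fun f _ => ?_
  have hP : 0 ≤ ∏ k ∈ univ.erase i, star3Weight p (f k) :=
    prod_nonneg fun _ _ => star3Weight_nonneg hp _
  have hmono (h : Function.update f i none ∈ F) (j : Fin 2) :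
      Function.update f i (some j) ∈ F := by
    simpa using hF _ h i (by simp) j
  simp only [Fintype.sum_option, Fin.sum_univ_two, Fin.exists_fin_two, star3WeightDeriv]
  by_cases h : Function.update f i none ∈ F
  · simp [h, hmono h]
    norm_num
  · by_cases h0 : Function.update f i (some 0) ∈ F <;>
      by_cases h1 : Function.update f i (some 1) ∈ F <;>
      simp [h, h0, h1] <;> linarith

/-- For a monotone family `𝔽 ⊆ {1,2,*}^m` and `ε ∈ (0,1)`, there exists
`p' ∈ [1-ε, 1-ε/2]` with `as_{p'}(𝔽) ≤ 4/ε`. -/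
theorem exists_small_avgSens {m : ℕ} (F : Finset (Fin m → Star3))
    (hF : MonotoneFamily F) (ε : ℝ) (hε : ε ∈ Set.Ioo (0 : ℝ) 1) :
    ∃ p' ∈ Set.Icc (1 - ε) (1 - ε / 2), avgSens p' F ≤ 4 / ε := by
  obtain ⟨h0, h1⟩ := hε
  obtain ⟨p, hp, hslope⟩ := exists_hasDerivAt_eq_slope (fun q => muP q F)
    (fun q => ∑ i, muPDerivCoord q F i) (show 1 - ε < 1 - ε / 2 by linarith)
    (fun q _ => (hasDerivAt_muP q F).continuousAt.continuousWithinAt)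
    (fun q _ => hasDerivAt_muP q F)
  refine ⟨p, Set.Ioo_subset_Icc_self hp, ?_⟩
  have hp01 : p ∈ Set.Icc (0 : ℝ) 1 := ⟨by linarith [hp.1], by linarith [hp.2]⟩
  have hupper := muP_le_one (p := 1 - ε / 2) ⟨by linarith, by linarith⟩ F
  have hlower := muP_nonneg (p := 1 - ε) ⟨by linarith, by linarith⟩ F
  calc avgSens p F ≤ ∑ i, 2 * muPDerivCoord p F i :=
        sum_le_sum fun i _ => infP_le_two_mul_muPDerivCoord hp01 hF i
    _ = 2 * ((muP (1 - ε / 2) F - muP (1 - ε) F) / (ε / 2)) := by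
        rw [← mul_sum, hslope]
        ring_nf
    _ ≤ 2 * (1 / (ε / 2)) := by
        gcongr
        linarith
    _ = 4 / ε := by
        field_simp
        norm_num
end

section
/- Let η ∈ (0,1), let ε ∈ (0,2], and let A ⊆ {−1,1}^n satisfy |A|/2^n ≥ ε/2. Let y be uniform on {−1,1}^n and let y' be a (1−η)-correlated copy of y. Then Pr[y ∈ A and −y' ∈ A] ≥ (ε/2)^{4/η}. -/
open Finset

/-- The probability of the pair `(y, y')` where `y` is uniform on `{−1,1}^n`
(encoded by `Bool`) and `y'` is a `ρ`-correlated copy of `y`: coordinatewise,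
`y'_i = y_i` with probability `(1+ρ)/2` and `y'_i = −y_i` with probability
`(1−ρ)/2`, independently. -/
noncomputable def corrPairProb (n : ℕ) (ρ : ℝ) (y y' : Fin n → Bool) : ℝ :=
  (1 / 2 ^ n) * ∏ i, (if y i = y' i then (1 + ρ) / 2 else (1 - ρ) / 2)

/-- Midpoint convexity of `t ↦ t ^ k`, combined with Bernoulli's inequality. -/
lemma two_mul_one_add_le_rpow_add_rpow {k m u v : ℝ} (hk : 1 ≤ k) (hu : 0 ≤ u) (hv : 0 ≤ v)
    (huv : u + v = 2 * (1 + m)) : 2 * (1 + k * m) ≤ u ^ k + v ^ k := by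
  have hconv := (convexOn_rpow hk).2 (Set.mem_Ici.2 hu) (Set.mem_Ici.2 hv)
    (by norm_num : (0 : ℝ) ≤ 1 / 2) (by norm_num : (0 : ℝ) ≤ 1 / 2) (by norm_num)
  simp only [smul_eq_mul] at hconv
  rw [show 1 / 2 * u + 1 / 2 * v = 1 + m by linarith] at hconv
  have hbern := one_add_mul_self_le_rpow_one_add (s := m) (by linarith) hk
  linarith

lemma rpow_eq_rpow_half_sq {u : ℝ} (hu : 0 ≤ u) (k : ℝ) : u ^ k = (u ^ (k / 2)) ^ 2 := by
  rw [← Real.rpow_natCast, ← Real.rpow_mul hu]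
  congr 1
  push_cast
  ring

/-- A second-order lower bound for a symmetric sum of powers with well-separated bases. -/
lemma second_order_le_rpow_add_rpow {k m s : ℝ} (hk : 2 ≤ k) (hm : 0 ≤ m) (hs : 0 ≤ s)
    (hsm : 4 * m ≤ s ^ 2) (hsle : s ≤ 1 + m) :
    2 * (1 + k * (k - 1) * m) ≤ (1 + m + s) ^ k + (1 + m - s) ^ k := by
  have hu : 0 ≤ 1 + m + s := by linarith
  have hv : 0 ≤ 1 + m - s := by linarith
  have hu1 : 1 + k / 2 * (m + s) ≤ (1 + m + s) ^ (k / 2) := by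
    rw [add_assoc 1 m s]
    exact one_add_mul_self_le_rpow_one_add (by linarith) (by linarith)
  have hv1 : 1 + k / 2 * (m - s) ≤ (1 + m - s) ^ (k / 2) := by
    rw [add_sub_assoc 1 m s]
    exact one_add_mul_self_le_rpow_one_add (by linarith) (by linarith)
  have hkm : 0 ≤ k * m := by positivity
  have hks : 0 ≤ k * s := by positivity
  have hU : (1 + k / 2 * (m + s)) ^ 2 ≤ (1 + m + s) ^ k := by
    rw [rpow_eq_rpow_half_sq hu]
    exact pow_le_pow_left₀ (by nlinarith) hu1 2
  have hV0 : 0 ≤ (1 + m - s) ^ k := Real.rpow_nonneg hv k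
  have hksm : 4 * (k ^ 2 * m) ≤ (k * s) ^ 2 := by
    nlinarith [mul_le_mul_of_nonneg_left hsm (sq_nonneg k)]
  rcases le_or_gt 0 (1 + k / 2 * (m - s)) with h | h
  · have hV : (1 + k / 2 * (m - s)) ^ 2 ≤ (1 + m - s) ^ k := by
      rw [rpow_eq_rpow_half_sq hv]
      exact pow_le_pow_left₀ h hv1 2
    nlinarith [sq_nonneg (k * m)]
  · obtain ⟨r, hr, rfl⟩ : ∃ r : ℝ, 0 ≤ r ∧ m = r ^ 2 :=
      ⟨√m, Real.sqrt_nonneg m, (Real.sq_sqrt hm).symm⟩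
    have hw : 0 ≤ k * r := by positivity
    rcases le_or_gt 1 (k * r) with hw1 | hw1
    · have hrs : 2 * r ≤ s := by
        apply le_of_sq_le_sq _ hs
        linarith
      have hle : ((1 + r) ^ 2) ^ k ≤ (1 + r ^ 2 + s) ^ k :=
        Real.rpow_le_rpow (by positivity) (by linarith) (by linarith)
      have hr1 : 1 + k / 2 * r ≤ (1 + r) ^ (k / 2) :=
        one_add_mul_self_le_rpow_one_add (by linarith) (by linarith)
      have hfour : (1 + k / 2 * r) ^ 4 ≤ ((1 + r) ^ 2) ^ k := by
        have heq : ((1 + r) ^ 2) ^ k = ((1 + r) ^ (k / 2)) ^ 4 := by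
          rw [← Real.rpow_natCast, ← Real.rpow_natCast, ← Real.rpow_mul (by positivity),
            ← Real.rpow_mul (by positivity)]
          congr 1
          push_cast
          ring
        rw [heq]
        exact pow_le_pow_left₀ (by positivity) hr1 4
      have hpoly : 2 * (1 + (k * r) ^ 2) ≤ (1 + k / 2 * r) ^ 4 := by
        obtain ⟨t, ht, hkr⟩ : ∃ t : ℝ, 0 ≤ t ∧ k * r = 1 + t := ⟨k * r - 1, by linarith, by ring⟩
        rw [show 1 + k / 2 * r = (3 + t) / 2 by linarith, hkr]
        have h3 : 0 ≤ t ^ 3 := by positivity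
        have h4 : 0 ≤ t ^ 4 := by positivity
        nlinarith [sq_nonneg t]
      nlinarith
    · nlinarith

/-- The two-point inequality for functions of mean one. -/
lemma one_le_two_point {k x y : ℝ} (hk : 2 ≤ k) (hx : |x| ≤ 1) (hy : |y| ≤ 1) :
    1 ≤ 1 / 2 * ((1 - 1 / k) * (((1 + x) * (1 + y)) ^ k + ((1 - x) * (1 - y)) ^ k)
      + 1 / k * (((1 + x) * (1 - y)) ^ k + ((1 - x) * (1 + y)) ^ k)) := by
  wlog hxy : y ≤ x generalizing x y
  · have h := this (x := -x) (y := -y) (by simpa using hx) (by simpa using hy) (by linarith)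
    simp only [sub_neg_eq_add, ← sub_eq_add_neg] at h
    linarith
  obtain ⟨hx1, hx2⟩ := abs_le.1 hx
  obtain ⟨hy1, hy2⟩ := abs_le.1 hy
  have hpp : 0 ≤ (1 + x) * (1 + y) := mul_nonneg (by linarith) (by linarith)
  have hmm : 0 ≤ (1 - x) * (1 - y) := mul_nonneg (by linarith) (by linarith)
  have hpm : 0 ≤ (1 + x) * (1 - y) := mul_nonneg (by linarith) (by linarith)
  have hmp : 0 ≤ (1 - x) * (1 + y) := mul_nonneg (by linarith) (by linarith)
  have hk0 : 0 < k := by linarith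
  have hk1 : 0 ≤ 1 / k := by positivity
  have hk2 : 0 ≤ 1 - 1 / k := by
    rw [sub_nonneg, div_le_one hk0]
    linarith
  have hagree := two_mul_one_add_le_rpow_add_rpow (k := k) (m := x * y) (by linarith) hpp hmm
    (by ring)
  rcases le_total 0 (x * y) with h | h
  · have hdis := two_mul_one_add_le_rpow_add_rpow (k := k) (m := -(x * y)) (by linarith) hpm hmp
      (by ring)
    have hsum := add_le_add (mul_le_mul_of_nonneg_left hagree hk2)
      (mul_le_mul_of_nonneg_left hdis hk1)
    have heq : (1 - 1 / k) * (2 * (1 + k * (x * y))) + 1 / k * (2 * (1 + k * -(x * y)))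
        = 2 + 2 * ((k - 2) * (x * y)) := by
      field_simp
      ring
    have hnn : 0 ≤ (k - 2) * (x * y) := mul_nonneg (by linarith) h
    linarith
  · have hdis := second_order_le_rpow_add_rpow (k := k) (m := -(x * y)) (s := x - y) hk
      (by linarith) (by linarith) (by nlinarith [sq_nonneg (x + y)]) (by linarith)
    rw [show 1 + -(x * y) + (x - y) = (1 + x) * (1 - y) by ring,
      show 1 + -(x * y) - (x - y) = (1 - x) * (1 + y) by ring] at hdis
    have hsum := add_le_add (mul_le_mul_of_nonneg_left hagree hk2)
      (mul_le_mul_of_nonneg_left hdis hk1)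
    have heq : (1 - 1 / k) * (2 * (1 + k * (x * y)))
        + 1 / k * (2 * (1 + k * (k - 1) * -(x * y))) = 2 := by
      field_simp
      ring
    linarith

/-- The two-point reverse hypercontractive inequality. -/
lemma rpow_le_two_point {k a b c d : ℝ} (hk : 2 ≤ k) (ha : 0 ≤ a) (hb : 0 ≤ b) (hc : 0 ≤ c)
    (hd : 0 ≤ d) :
    ((a + b) / 2 * ((c + d) / 2)) ^ k ≤
      1 / 2 * ((1 - 1 / k) * ((a * c) ^ k + (b * d) ^ k)
        + 1 / k * ((a * d) ^ k + (b * c) ^ k)) := by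
  have hk0 : 0 < k := by linarith
  have hk2 : 0 ≤ 1 - 1 / k := by
    rw [sub_nonneg, div_le_one hk0]
    linarith
  rcases (add_nonneg ha hb).eq_or_lt with hab | hab
  · rw [← hab, zero_div, zero_mul, Real.zero_rpow hk0.ne']
    positivity
  rcases (add_nonneg hc hd).eq_or_lt with hcd | hcd
  · rw [← hcd, zero_div, mul_zero, Real.zero_rpow hk0.ne']
    positivity
  have habs : ∀ {p q : ℝ}, 0 ≤ p → 0 ≤ q → 0 < p + q → |(p - q) / (p + q)| ≤ 1 := by
    intro p q hp hq hpq
    rw [abs_div, abs_of_pos hpq, div_le_one hpq, abs_le]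
    constructor <;> linarith
  have hplus : ∀ {p q : ℝ}, 0 < p + q → 1 + (p - q) / (p + q) = p / ((p + q) / 2) := by
    intro p q hpq
    field_simp
    ring
  have hminus : ∀ {p q : ℝ}, 0 < p + q → 1 - (p - q) / (p + q) = q / ((p + q) / 2) := by
    intro p q hpq
    field_simp
    ring
  have h := one_le_two_point hk (habs ha hb hab) (habs hc hd hcd)
  rw [hplus hab, hminus hab, hplus hcd, hminus hcd] at h
  have hM : 0 < (a + b) / 2 * ((c + d) / 2) := by positivity
  simp only [div_mul_div_comm a, div_mul_div_comm b] at h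
  rw [Real.div_rpow (mul_nonneg ha hc) hM.le, Real.div_rpow (mul_nonneg hb hd) hM.le,
    Real.div_rpow (mul_nonneg ha hd) hM.le, Real.div_rpow (mul_nonneg hb hc) hM.le] at h
  refine (le_mul_of_one_le_right (Real.rpow_nonneg hM.le k) h).trans_eq ?_
  have hMk := (Real.rpow_pos_of_pos hM k).ne'
  field_simp

lemma sum_fin_succ_bool {n : ℕ} (F : (Fin (n + 1) → Bool) → ℝ) :
    ∑ y, F y =
      ∑ y : Fin n → Bool, F (Fin.cons true y) + ∑ y : Fin n → Bool, F (Fin.cons false y) := by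
  rw [← (Fin.consEquiv fun _ : Fin (n + 1) => Bool).sum_comp, Fintype.sum_prod_type,
    Fintype.sum_bool]
  rfl

lemma corrPairProb_cons {n : ℕ} (ρ : ℝ) (b b' : Bool) (y y' : Fin n → Bool) :
    corrPairProb (n + 1) ρ (Fin.cons b y) (Fin.cons b' y') =
      1 / 2 * (if b = b' then (1 + ρ) / 2 else (1 - ρ) / 2) * corrPairProb n ρ y y' := by
  simp only [corrPairProb, Fin.prod_univ_succ, Fin.cons_zero, Fin.cons_succ, pow_succ]
  ring

/-- Reverse hypercontractivity on the discrete cube, for exponents `1 / k`. -/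
lemma rpow_mean_mul_mean_le {k : ℝ} (hk : 2 ≤ k) {n : ℕ} (f g : (Fin n → Bool) → ℝ)
    (hf : ∀ y, 0 ≤ f y) (hg : ∀ y, 0 ≤ g y) :
    ((∑ y, f y) / 2 ^ n * ((∑ y, g y) / 2 ^ n)) ^ k ≤
      ∑ y, ∑ y', (f y * g y') ^ k * corrPairProb n (1 - 2 / k) y y' := by
  induction n with
  | zero => simp [corrPairProb]
  | succ n ih =>
    have hmean : ∀ {h : (Fin n → Bool) → ℝ}, (∀ y, 0 ≤ h y) → 0 ≤ (∑ y, h y) / 2 ^ n :=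
      fun h0 => div_nonneg (sum_nonneg fun y _ => h0 y) (by positivity)
    have hk0 : 0 < k := by linarith
    have hk1 : 0 ≤ 1 / k := by positivity
    have hk2 : 0 ≤ 1 - 1 / k := by
      rw [sub_nonneg, div_le_one hk0]
      linarith
    have key := rpow_le_two_point hk
      (hmean fun y => hf (Fin.cons true y)) (hmean fun y => hf (Fin.cons false y))
      (hmean fun y => hg (Fin.cons true y)) (hmean fun y => hg (Fin.cons false y))
    have hstep (b b' : Bool) := ih (fun y => f (Fin.cons b y)) (fun y => g (Fin.cons b' y))
      (fun y => hf _) (fun y => hg _)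
    have hagree := mul_le_mul_of_nonneg_left
      (add_le_add (hstep true true) (hstep false false)) hk2
    have hdis := mul_le_mul_of_nonneg_left
      (add_le_add (hstep true false) (hstep false true)) hk1
    have hlhs : ∀ F : (Fin (n + 1) → Bool) → ℝ, (∑ y, F y) / 2 ^ (n + 1) =
        ((∑ y : Fin n → Bool, F (Fin.cons true y)) / 2 ^ n
          + (∑ y : Fin n → Bool, F (Fin.cons false y)) / 2 ^ n) / 2 := by
      intro F
      rw [sum_fin_succ_bool, pow_succ]
      field_simp
    have hterm (b b' : Bool) :
        ∑ y : Fin n → Bool, ∑ y' : Fin n → Bool, (f (Fin.cons b y) * g (Fin.cons b' y')) ^ k *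
          corrPairProb (n + 1) (1 - 2 / k) (Fin.cons b y) (Fin.cons b' y') =
        1 / 2 * (if b = b' then 1 - 1 / k else 1 / k) *
          ∑ y : Fin n → Bool, ∑ y' : Fin n → Bool, (f (Fin.cons b y) * g (Fin.cons b' y')) ^ k *
            corrPairProb n (1 - 2 / k) y y' := by
      simp only [mul_sum, corrPairProb_cons]
      rw [show (1 + (1 - 2 / k)) / 2 = 1 - 1 / k by ring,
        show (1 - (1 - 2 / k)) / 2 = 1 / k by ring]
      exact sum_congr rfl fun y _ => sum_congr rfl fun y' _ => by ring
    rw [hlhs, hlhs]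
    simp only [sum_fin_succ_bool, sum_add_distrib, hterm]
    simp only [if_true, Bool.true_eq_false, Bool.false_eq_true, if_false]
    linarith

/-- If `A ⊆ {−1,1}^n` has density at least `ε/2` and `(y, y')` is a
`(1−η)`-correlated pair, then `Pr[y ∈ A and −y' ∈ A] ≥ (ε/2)^{4/η}`. -/
theorem prob_self_neg_correlated (n : ℕ) (η ε : ℝ)
    (hη : η ∈ Set.Ioo (0 : ℝ) 1) (hε : ε ∈ Set.Ioc (0 : ℝ) 2)
    (A : Finset (Fin n → Bool)) (hA : ε / 2 ≤ (A.card : ℝ) / 2 ^ n) :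
    (ε / 2) ^ ((4 : ℝ) / η) ≤
      ∑ y : Fin n → Bool, ∑ y' : Fin n → Bool,
        (if y ∈ A ∧ (fun i => !(y' i)) ∈ A then corrPairProb n (1 - η) y y' else 0) := by
  obtain ⟨hη0, hη1⟩ := hη
  have hε0 : 0 < ε := hε.1
  have hk : 2 ≤ 2 / η := by
    rw [le_div_iff₀ hη0]
    linarith
  have hcard : ∑ y : Fin n → Bool, (if y ∈ A then (1 : ℝ) else 0) = A.card := by simp
  have hnegcard : ∑ y : Fin n → Bool, (if (fun i => !(y i)) ∈ A then (1 : ℝ) else 0) = A.card := by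
    rw [← hcard]
    have hinv : Function.Involutive fun (y : Fin n → Bool) i => !(y i) := fun y => by simp
    exact Equiv.sum_comp hinv.toPerm fun y => if y ∈ A then (1 : ℝ) else 0
  have h := rpow_mean_mul_mean_le hk (fun y : Fin n → Bool => if y ∈ A then (1 : ℝ) else 0)
    (fun y => if (fun i => !(y i)) ∈ A then (1 : ℝ) else 0)
    (fun y => by positivity) (fun y => by positivity)
  rw [hcard, hnegcard, show 2 / (2 / η) = η by field_simp] at h
  calc (ε / 2) ^ (4 / η) = (ε / 2 * (ε / 2)) ^ (2 / η) := by
        rw [← sq, ← Real.rpow_natCast, ← Real.rpow_mul (by positivity)]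
        congr 1
        push_cast
        ring
    _ ≤ ((A.card : ℝ) / 2 ^ n * ((A.card : ℝ) / 2 ^ n)) ^ (2 / η) := by gcongr
    _ ≤ _ := h
    _ = _ := by
        refine sum_congr rfl fun y _ => sum_congr rfl fun y' _ => ?_
        have hk0 : 2 / η ≠ 0 := by positivity
        by_cases h1 : y ∈ A <;> by_cases h2 : (fun i => !(y' i)) ∈ A <;>
          simp [h1, h2, Real.zero_rpow hk0]
end
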